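/- For every λ₀ > 0 and d ≥ 0, there exists a unique t ∈ (0, 1] such that t·e^{-t} = e^{-(d+1)}; moreover, every λ₁ ≥ λ₀ satisfying log(λ₁/λ₀) + λ₀/λ₁ − 1 ≤ d satisfies λ₁ ≤ λ₀/t. Consequently, the minimum of the means 1/λ₁ over all exponential rates λ₁ ≥ λ₀ with D_KL(Exp(λ₁)‖Exp(λ₀)) ≤ d equals t/λ₀. -/

import Mathlib

theorem aux_mono {s t : ℝ} (hs : 0 < s) (hst : s < t) (ht : t ≤ 1) :
    Real.log s - s < Real.log t - t := by
  have ht0 : 0 < t := hs.trans hst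
  have h1 : Real.log (s / t) < s / t - 1 :=
    Real.log_lt_sub_one_of_pos (by positivity) (by
      intro h
      rw [div_eq_one_iff_eq ht0.ne'] at h
      linarith)
  rw [Real.log_div hs.ne' ht0.ne'] at h1
  have h2 : s / t - 1 ≤ s - t := by
    rw [div_sub_one ht0.ne', div_le_iff₀ ht0]
    nlinarith
  linarith

theorem aux_eq {t d : ℝ} (ht : 0 < t) (h : t * Real.exp (-t) = Real.exp (-(d + 1))) :
    Real.log t - t = -(d + 1) := by
  have := congrArg Real.log h
  rw [Real.log_mul ht.ne' (Real.exp_pos _).ne', Real.log_exp, Real.log_exp] at this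
  linarith

/-- For every `λ₀ > 0` and `d ≥ 0`, there exists a unique `t ∈ (0, 1]`
with `t·e^{-t} = e^{-(d+1)}`; every `λ₁ ≥ λ₀` with `log(λ₁/λ₀) + λ₀/λ₁ − 1 ≤ d`
satisfies `λ₁ ≤ λ₀/t`; and the minimum of the means `1/λ₁` over all such rates
equals `t/λ₀`. -/
theorem stmt13 (lam₀ d : ℝ) (h₀ : 0 < lam₀) (hd : 0 ≤ d) :
    ∃ t : ℝ, t ∈ Set.Ioc (0:ℝ) 1 ∧
      t * Real.exp (-t) = Real.exp (-(d + 1)) ∧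
      (∀ t' ∈ Set.Ioc (0:ℝ) 1, t' * Real.exp (-t') = Real.exp (-(d + 1)) → t' = t) ∧
      (∀ l : ℝ, lam₀ ≤ l → Real.log (l / lam₀) + lam₀ / l - 1 ≤ d → l ≤ lam₀ / t) ∧
      IsLeast {m : ℝ | ∃ l : ℝ, lam₀ ≤ l ∧ Real.log (l / lam₀) + lam₀ / l - 1 ≤ d ∧
        m = 1 / l} (t / lam₀) := by
  obtain ⟨t, ht, hte⟩ : ∃ t ∈ Set.Icc (0:ℝ) 1,
      t * Real.exp (-t) = Real.exp (-(d + 1)) := by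
    have hc : ContinuousOn (fun t : ℝ => t * Real.exp (-t)) (Set.Icc 0 1) := by fun_prop
    have := intermediate_value_Icc (zero_le_one) hc
    refine this ⟨?_, ?_⟩
    · simpa using (Real.exp_pos _).le
    · simpa using hd
  have ht0 : 0 < t := by
    rcases ht.1.lt_or_eq with h | h
    · exact h
    · exfalso
      rw [← h, zero_mul] at hte
      exact (Real.exp_pos _).ne hte
  have ht1 : t ≤ 1 := ht.2
  have hlog := aux_eq ht0 hte
  have key : ∀ l : ℝ, lam₀ ≤ l → Real.log (l / lam₀) + lam₀ / l - 1 ≤ d → l ≤ lam₀ / t := by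
    intro l hl hk
    have hl0 : 0 < l := h₀.trans_le hl
    by_contra! hcon
    have hs : lam₀ / l < t := by
      rw [div_lt_iff₀ ht0] at hcon
      rw [div_lt_iff₀ hl0]
      linarith
    have := aux_mono (by positivity) hs ht1
    rw [Real.log_div h₀.ne' hl0.ne'] at this
    rw [Real.log_div hl0.ne' h₀.ne'] at hk
    linarith
  refine ⟨t, ⟨ht0, ht1⟩, hte, ?_, key, ?_, ?_⟩
  · intro t' ht' he
    have h' := aux_eq ht'.1 he
    rcases lt_trichotomy t' t with h | h | h
    · have := aux_mono ht'.1 h ht1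
      linarith
    · exact h
    · have := aux_mono ht0 h ht'.2
      linarith
  · refine ⟨lam₀ / t, ?_, ?_, ?_⟩
    · rw [le_div_iff₀ ht0]
      nlinarith
    · have e1 : lam₀ / t / lam₀ = t⁻¹ := by field_simp
      have e2 : lam₀ / (lam₀ / t) = t := by field_simp
      rw [e1, e2, Real.log_inv]
      linarith
    · rw [one_div_div]
  · rintro m ⟨l, hl, hk, rfl⟩
    have := key l hl hk
    have hl0 : 0 < l := h₀.trans_le hl
    rw [le_div_iff₀ ht0] at this
    rw [div_le_div_iff₀ h₀ hl0]
    linarith
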